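/- Let B be an invertible real d×d matrix and Γ = Bℤ^d a full lattice in ℝ^d. Let ℓ be a positive integer and let Ω ⊆ ℝ^d be a bounded Lebesgue measurable set such that ∑_{γ∈Γ} 1_Ω(ω+γ) ≤ ℓ for almost every ω ∈ ℝ^d and {ω ∈ ℝ^d : ∑_{γ∈Γ} 1_Ω(ω+γ) = ℓ} has positive Lebesgue measure. Then there exists a bounded Lebesgue measurable set Δ ⊆ ℝ^d with Ω ⊆ Δ such that ∑_{γ∈Γ} 1_Δ(ω+γ) = ℓ for almost every ω ∈ ℝ^d. -/

import Mathlib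

open MeasureTheory ENNReal

/-- The lattice `B ℤ^d` in `ℝ^d`, for an invertible `d × d` real matrix `B`. -/
def latticeOf (d : ℕ) (B : Matrix (Fin d) (Fin d) ℝ) : Set (Fin d → ℝ) :=
  {v | ∃ k : Fin d → ℤ, v = B.mulVec fun i => (k i : ℝ)}

section LatticeMultiplicity

variable {d : ℕ} (B : Matrix (Fin d) (Fin d) ℝ)

/-- The lattice point `B k`. -/
noncomputable def latticePoint (k : Fin d → ℤ) : Fin d → ℝ :=
  B.mulVec fun i => (k i : ℝ)

/-- The index of the translate of the fundamental cell `B [0, 1)^d` that contains `x`. -/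
noncomputable def cellIndex (x : Fin d → ℝ) : Fin d → ℤ :=
  fun i => ⌊B⁻¹.mulVec x i⌋

/-- The multiplicity with which the translates of `S` by `B ℤ^d` cover `x`. -/
noncomputable def latticeMultiplicity (S : Set (Fin d → ℝ)) (x : Fin d → ℝ) : ℝ≥0∞ :=
  ∑' k : Fin d → ℤ, S.indicator (fun _ => (1 : ℝ≥0∞)) (x + latticePoint B k)

variable {B}

lemma inv_mulVec_latticePoint (hB : IsUnit B.det) (k : Fin d → ℤ) :
    B⁻¹.mulVec (latticePoint B k) = fun i => (k i : ℝ) := by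
  simp [latticePoint, Matrix.mulVec_mulVec, Matrix.nonsing_inv_mul B hB]

lemma latticePoint_injective (hB : IsUnit B.det) : Function.Injective (latticePoint B) := by
  intro k l h
  have h' := congrArg B⁻¹.mulVec h
  rw [inv_mulVec_latticePoint hB, inv_mulVec_latticePoint hB] at h'
  funext i
  exact_mod_cast congrFun h' i

lemma latticePoint_add (k l : Fin d → ℤ) :
    latticePoint B (k + l) = latticePoint B k + latticePoint B l := by
  rw [latticePoint, latticePoint, latticePoint, ← Matrix.mulVec_add]
  congr 1
  funext i
  simp

lemma tsum_latticeOf (hB : IsUnit B.det) (f : (Fin d → ℝ) → ℝ≥0∞) :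
    ∑' γ : latticeOf d B, f γ = ∑' k : Fin d → ℤ, f (latticePoint B k) := by
  have hbij : Function.Bijective
      (fun k : Fin d → ℤ => (⟨latticePoint B k, k, rfl⟩ : latticeOf d B)) := by
    refine ⟨fun k l h => latticePoint_injective hB (congrArg Subtype.val h), ?_⟩
    rintro ⟨v, k, rfl⟩
    exact ⟨k, rfl⟩
  exact ((Equiv.ofBijective _ hbij).tsum_eq (fun γ : latticeOf d B => f γ)).symm

lemma cellIndex_add_latticePoint (hB : IsUnit B.det) (x : Fin d → ℝ) (k : Fin d → ℤ) :
    cellIndex B (x + latticePoint B k) = k + cellIndex B x := by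
  funext i
  simp [cellIndex, Matrix.mulVec_add, inv_mulVec_latticePoint hB, add_comm]

lemma measurable_cellIndex : Measurable (cellIndex B) :=
  measurable_pi_lambda _ fun i => Int.measurable_floor.comp
    ((continuous_apply i).comp (Continuous.matrix_mulVec continuous_const continuous_id)).measurable

lemma isBounded_cellIndex_eq (hB : IsUnit B.det) (k : Fin d → ℤ) :
    Bornology.IsBounded {x | cellIndex B x = k} := by
  have hcont : Continuous fun y : Fin d → ℝ => B.mulVec y :=
    Continuous.matrix_mulVec continuous_const continuous_id
  refine ((isCompact_Icc (a := fun i => (k i : ℝ))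
    (b := fun i => (k i : ℝ) + 1)).image hcont).isBounded.subset ?_
  rintro x rfl
  refine ⟨B⁻¹.mulVec x, ⟨fun i => Int.floor_le _, fun i => (Int.lt_floor_add_one _).le⟩, ?_⟩
  simp [Matrix.mulVec_mulVec, Matrix.mul_nonsing_inv B hB]

lemma exists_cellIndex_lt {S : Set (Fin d → ℝ)} (hS : Bornology.IsBounded S) (i : Fin d) :
    ∃ N : ℤ, ∀ x ∈ S, cellIndex B x i < N := by
  have hcont : Continuous fun x : Fin d → ℝ => B⁻¹.mulVec x i :=
    (continuous_apply i).comp (Continuous.matrix_mulVec continuous_const continuous_id)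
  obtain ⟨M, hM⟩ := (hS.isCompact_closure.image hcont).bddAbove
  refine ⟨⌊M⌋ + 1, fun x hx => Int.lt_add_one_of_le (Int.floor_le_floor ?_)⟩
  exact hM ⟨x, subset_closure hx, rfl⟩

lemma latticeMultiplicity_add_latticePoint (S : Set (Fin d → ℝ)) (x : Fin d → ℝ) (k : Fin d → ℤ) :
    latticeMultiplicity B S (x + latticePoint B k) = latticeMultiplicity B S x := by
  unfold latticeMultiplicity
  simpa [latticePoint_add, add_assoc] using (Equiv.addLeft k).tsum_eq
    fun l => S.indicator (fun _ => (1 : ℝ≥0∞)) (x + latticePoint B l)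

lemma measurable_latticeMultiplicity {S : Set (Fin d → ℝ)} (hS : MeasurableSet S) :
    Measurable (latticeMultiplicity B S) :=
  Measurable.tsum fun _ =>
    (measurable_const.indicator hS).comp (measurable_id.add_const _)

lemma tsum_indicator_one_eq_encard {α : Type*} (s : Set α) :
    ∑' a, s.indicator (fun _ => (1 : ℝ≥0∞)) a = s.encard := by
  rw [← tsum_subtype, ENNReal.tsum_set_one]

lemma latticeMultiplicity_eq_encard (S : Set (Fin d → ℝ)) (x : Fin d → ℝ) :
    latticeMultiplicity B S x = ({k | x + latticePoint B k ∈ S} : Set (Fin d → ℤ)).encard := by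
  rw [← tsum_indicator_one_eq_encard]
  rfl

lemma latticeMultiplicity_union {S T : Set (Fin d → ℝ)} (h : Disjoint S T) (x : Fin d → ℝ) :
    latticeMultiplicity B (S ∪ T) x = latticeMultiplicity B S x + latticeMultiplicity B T x := by
  simp only [latticeMultiplicity, Set.indicator_union_of_disjoint h]
  exact ENNReal.tsum_add

/-- Points in the cells `k 0, k 1, …` where the covering by `S` is deficient: a point of
multiplicity `n` is kept in exactly the first `ℓ - n` of these cells. -/
def deficiencySet (B : Matrix (Fin d) (Fin d) ℝ) (S : Set (Fin d → ℝ)) (ℓ : ℕ)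
    (k : ℕ → Fin d → ℤ) : Set (Fin d → ℝ) :=
  ⋃ i ∈ Finset.range ℓ, {x | cellIndex B x = k i ∧ latticeMultiplicity B S x + i < ℓ}

lemma measurableSet_deficiencySet {S : Set (Fin d → ℝ)} (hS : MeasurableSet S) (ℓ : ℕ)
    (k : ℕ → Fin d → ℤ) : MeasurableSet (deficiencySet B S ℓ k) :=
  Finset.measurableSet_biUnion _ fun i _ =>
    (measurable_cellIndex (measurableSet_singleton (k i))).inter
      (measurableSet_lt ((measurable_latticeMultiplicity hS).add_const _) measurable_const)

lemma isBounded_deficiencySet (hB : IsUnit B.det) (S : Set (Fin d → ℝ)) (ℓ : ℕ)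
    (k : ℕ → Fin d → ℤ) : Bornology.IsBounded (deficiencySet B S ℓ k) :=
  (Bornology.isBounded_biUnion_finset _).2 fun i _ =>
    (isBounded_cellIndex_eq hB (k i)).subset fun _ hx => hx.1

lemma latticeMultiplicity_add_deficiencySet (hB : IsUnit B.det) {S : Set (Fin d → ℝ)} {ℓ : ℕ}
    {k : ℕ → Fin d → ℤ} (hk : Function.Injective k) {x : Fin d → ℝ}
    (hx : latticeMultiplicity B S x ≤ ℓ) :
    latticeMultiplicity B S x + latticeMultiplicity B (deficiencySet B S ℓ k) x = ℓ := by
  obtain ⟨n, hn⟩ : ∃ n : ℕ, latticeMultiplicity B S x = n := by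
    have h : ({k | x + latticePoint B k ∈ S} : Set (Fin d → ℤ)).encard ≠ ⊤ := by
      intro h
      rw [latticeMultiplicity_eq_encard, h] at hx
      simp at hx
    obtain ⟨n, hn⟩ := ENat.ne_top_iff_exists.1 h
    exact ⟨n, by rw [latticeMultiplicity_eq_encard, ← hn]; simp⟩
  have hnl : n ≤ ℓ := by
    rw [hn] at hx
    exact_mod_cast hx
  have hset : ({l | x + latticePoint B l ∈ deficiencySet B S ℓ k} : Set (Fin d → ℤ)) =
      (fun i => k i - cellIndex B x) '' (Finset.range (ℓ - n) : Set ℕ) := by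
    ext l
    simp only [deficiencySet, Set.mem_iUnion, Set.mem_ofPred_eq, Set.mem_image, Finset.mem_coe,
      Finset.mem_range, cellIndex_add_latticePoint hB, latticeMultiplicity_add_latticePoint, hn,
      exists_prop]
    refine exists_congr fun i => ?_
    have hlt : ((n : ℝ≥0∞) + i < ℓ) ↔ n + i < ℓ := by exact_mod_cast Iff.rfl
    rw [hlt, sub_eq_iff_eq_add, eq_comm (a := k i)]
    constructor
    · rintro ⟨-, h, h'⟩
      exact ⟨by omega, h⟩
    · rintro ⟨h, h'⟩
      exact ⟨by omega, h', by omega⟩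
  have hinj : Function.Injective fun i => k i - cellIndex B x :=
    fun i j h => hk (sub_left_injective h)
  rw [latticeMultiplicity_eq_encard (deficiencySet B S ℓ k), hset, hinj.encard_image,
    Set.encard_coe_eq_coe_finsetCard, Finset.card_range, hn]
  have hadd : (n : ℝ≥0∞) + ((ℓ - n : ℕ) : ℝ≥0∞) = ℓ := by
    exact_mod_cast Nat.add_sub_of_le hnl
  simpa using hadd

end LatticeMultiplicity

/-- Every bounded measurable `ℓ`-subtile `Ω` of `ℝ^d` by a full lattice `Γ = B ℤ^d` is
contained in a bounded measurable set `Δ` which is an exact `ℓ`-tile of `ℝ^d` by `Γ`. -/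
theorem subtile_extends_to_tile_Rd
    (d : ℕ) (B : Matrix (Fin d) (Fin d) ℝ) (hB : IsUnit B.det)
    (Ω : Set (Fin d → ℝ)) (hΩmeas : MeasurableSet Ω) (hΩbdd : Bornology.IsBounded Ω)
    (ℓ : ℕ) (hℓ : 0 < ℓ)
    (hsub : ∀ᵐ ω : Fin d → ℝ, (∑' γ : latticeOf d B,
        Ω.indicator (fun _ => (1 : ℝ≥0∞)) (ω + (γ : Fin d → ℝ))) ≤ (ℓ : ℝ≥0∞))
    (hsup : 0 < volume {ω : Fin d → ℝ | (∑' γ : latticeOf d B,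
        Ω.indicator (fun _ => (1 : ℝ≥0∞)) (ω + (γ : Fin d → ℝ))) = (ℓ : ℝ≥0∞)}) :
    ∃ Δ : Set (Fin d → ℝ), MeasurableSet Δ ∧ Bornology.IsBounded Δ ∧ Ω ⊆ Δ ∧
      (∀ᵐ ω : Fin d → ℝ, (∑' γ : latticeOf d B,
        Δ.indicator (fun _ => (1 : ℝ≥0∞)) (ω + (γ : Fin d → ℝ))) = (ℓ : ℝ≥0∞)) := by
  have hmult (S : Set (Fin d → ℝ)) (ω : Fin d → ℝ) : (∑' γ : latticeOf d B,
      S.indicator (fun _ => (1 : ℝ≥0∞)) (ω + (γ : Fin d → ℝ))) = latticeMultiplicity B S ω :=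
    tsum_latticeOf hB fun v => S.indicator (fun _ => (1 : ℝ≥0∞)) (ω + v)
  simp only [hmult] at hsub hsup ⊢
  obtain rfl | hd := Nat.eq_zero_or_pos d
  · obtain ⟨y, hy⟩ := nonempty_of_measure_ne_zero hsup.ne'
    refine ⟨Ω, hΩmeas, hΩbdd, subset_rfl, .of_forall fun x => ?_⟩
    rwa [Subsingleton.elim x y]
  obtain ⟨N, hN⟩ := exists_cellIndex_lt (B := B) hΩbdd ⟨0, hd⟩
  let k : ℕ → Fin d → ℤ := fun i _ => N + i
  have hk : Function.Injective k := fun i j h => by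
    have := congrFun h ⟨0, hd⟩
    simpa [k] using this
  have hdisj : Disjoint Ω (deficiencySet B Ω ℓ k) := by
    rw [Set.disjoint_left]
    intro x hx hx'
    simp only [deficiencySet, Set.mem_iUnion] at hx'
    obtain ⟨i, -, hi, -⟩ := hx'
    have h := hN x hx
    rw [hi] at h
    simp only [k] at h
    omega
  refine ⟨Ω ∪ deficiencySet B Ω ℓ k, hΩmeas.union (measurableSet_deficiencySet hΩmeas ℓ k),
    hΩbdd.union (isBounded_deficiencySet hB Ω ℓ k), Set.subset_union_left, ?_⟩
  filter_upwards [hsub] with x hx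
  rw [latticeMultiplicity_union hdisj, latticeMultiplicity_add_deficiencySet hB hk hx]
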